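/- Let W ⊆ ℝ^{2n+1} be a 3-dimensional linear subspace with e₁ ∈ W. Then W is closed under the Vidinli multiplication ∗, and the restriction (W, ∗) is isomorphic to the 3-dimensional Vidinli algebra V₃ (i.e. there exists a bijective ℝ-linear multiplicative map from W to V₃) if and only if there exist orthonormal vectors u, v ∈ W ∩ V₀ with ω(u, v) = ±1. In particular, if u, v ∈ V₀ are orthonormal with ω(u,v) = 1, then u ∗ v = e₁, v ∗ u = −e₁, and u ∗ u = v ∗ v = −e₁, so {e₁, u, v} reproduces the multiplication table of V₃. -/

import Mathlib

noncomputable section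

/-- Standard dot product on `ℝ^m`. -/
def dot {m : ℕ} (a b : Fin m → ℝ) : ℝ := ∑ i, a i * b i

/-- The distinguished unit vector `e₁` of the Vidinli algebra (index `0`). -/
def e1 (n : ℕ) : Fin (2*n+1) → ℝ := fun i => if i.val = 0 then 1 else 0

/-- The standard symplectic form `ω` on `ℝ^{2n+1}` (vanishing on `e₁`):
`ω(a,b) = Σ_{k=1}^n (a_{2k} b_{2k+1} − a_{2k+1} b_{2k})` in the paper's 1-based indexing. -/
def omg (n : ℕ) (a b : Fin (2*n+1) → ℝ) : ℝ :=
  ∑ k : Fin n,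
    (a ⟨2*k.val+1, by have := k.isLt; omega⟩ * b ⟨2*k.val+2, by have := k.isLt; omega⟩
   - a ⟨2*k.val+2, by have := k.isLt; omega⟩ * b ⟨2*k.val+1, by have := k.isLt; omega⟩)

/-- The Vidinli multiplication on `ℝ^{2n+1}`. -/
def vprod (n : ℕ) (a b : Fin (2*n+1) → ℝ) : Fin (2*n+1) → ℝ :=
  dot a (e1 n) • b + dot b (e1 n) • a - dot a b • e1 n + omg n a b • e1 n

section Forms

variable {m n : ℕ}

theorem dot_comm (a b : Fin m → ℝ) : dot a b = dot b a := dotProduct_comm a b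

theorem dot_add_left (a b c : Fin m → ℝ) : dot (a + b) c = dot a c + dot b c :=
  add_dotProduct a b c

theorem dot_smul_left (r : ℝ) (a b : Fin m → ℝ) : dot (r • a) b = r * dot a b :=
  smul_dotProduct r a b

theorem dot_sub_left (a b c : Fin m → ℝ) : dot (a - b) c = dot a c - dot b c :=
  sub_dotProduct a b c

theorem dot_add_right (a b c : Fin m → ℝ) : dot a (b + c) = dot a b + dot a c :=
  dotProduct_add a b c

theorem dot_smul_right (r : ℝ) (a b : Fin m → ℝ) : dot a (r • b) = r * dot a b :=
  dotProduct_smul r a b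

theorem dot_e1 (a : Fin (2*n+1) → ℝ) : dot a (e1 n) = a 0 := by
  rw [dot, Finset.sum_eq_single 0]
  · simp [e1]
  · intro i _ hi
    have : i.val ≠ 0 := fun h => hi (Fin.ext h)
    simp [e1, this]
  · simp

theorem dot_e1_e1 : dot (e1 n) (e1 n) = 1 := by
  rw [dot_e1]
  simp [e1]

theorem omg_swap (a b : Fin (2*n+1) → ℝ) : omg n b a = -omg n a b := by
  rw [omg, omg, ← Finset.sum_neg_distrib]
  exact Finset.sum_congr rfl fun k _ => by ring

theorem omg_self (a : Fin (2*n+1) → ℝ) : omg n a a = 0 := by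
  linarith [omg_swap a a]

theorem omg_add_left (a b c : Fin (2*n+1) → ℝ) :
    omg n (a + b) c = omg n a c + omg n b c := by
  simp only [omg, ← Finset.sum_add_distrib, Pi.add_apply]
  exact Finset.sum_congr rfl fun k _ => by ring

theorem omg_smul_left (r : ℝ) (a b : Fin (2*n+1) → ℝ) :
    omg n (r • a) b = r * omg n a b := by
  simp only [omg, Finset.mul_sum, Pi.smul_apply, smul_eq_mul]
  exact Finset.sum_congr rfl fun k _ => by ring

theorem omg_add_right (a b c : Fin (2*n+1) → ℝ) :
    omg n a (b + c) = omg n a b + omg n a c := by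
  rw [omg_swap (b + c), omg_add_left, omg_swap a b, omg_swap a c]
  ring

theorem omg_smul_right (r : ℝ) (a b : Fin (2*n+1) → ℝ) :
    omg n a (r • b) = r * omg n a b := by
  rw [omg_swap (r • b), omg_smul_left, omg_swap a b]
  ring

theorem omg_e1_left (a : Fin (2*n+1) → ℝ) : omg n (e1 n) a = 0 := by
  simp [omg, e1]

theorem omg_e1_right (a : Fin (2*n+1) → ℝ) : omg n a (e1 n) = 0 := by
  rw [omg_swap (e1 n), omg_e1_left, neg_zero]

end Forms

section Product

variable {n : ℕ}

theorem vprod_e1_left (a : Fin (2*n+1) → ℝ) : vprod n (e1 n) a = a := by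
  rw [vprod, dot_e1_e1, omg_e1_left, dot_comm (e1 n) a]
  module

theorem vprod_e1_right (a : Fin (2*n+1) → ℝ) : vprod n a (e1 n) = a := by
  rw [vprod, dot_e1_e1, omg_e1_right]
  module

theorem vprod_self (a : Fin (2*n+1) → ℝ) :
    vprod n a a = (2 * dot a (e1 n)) • a - dot a a • e1 n := by
  rw [vprod, omg_self]
  module

theorem vprod_of_dot_e1_eq_zero {a b : Fin (2*n+1) → ℝ} (ha : dot a (e1 n) = 0)
    (hb : dot b (e1 n) = 0) : vprod n a b = (omg n a b - dot a b) • e1 n := by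
  rw [vprod, ha, hb]
  module

theorem vprod_one (a b : Fin (2*1+1) → ℝ) :
    vprod 1 a b = ![a 0 * b 0 - a 1 * b 1 - a 2 * b 2 + (a 1 * b 2 - a 2 * b 1),
      a 0 * b 1 + b 0 * a 1, a 0 * b 2 + b 0 * a 2] := by
  have hdot : dot a b = a 0 * b 0 + a 1 * b 1 + a 2 * b 2 := Fin.sum_univ_three _
  have homg : omg 1 a b = a 1 * b 2 - a 2 * b 1 := Fin.sum_univ_one _
  have h0 : e1 1 0 = 1 := rfl
  have h1 : e1 1 1 = 0 := rfl
  have h2 : e1 1 2 = 0 := rfl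
  rw [vprod, dot_e1, dot_e1, hdot, homg]
  ext i
  fin_cases i
  · simp [h0]
    ring
  · simp [h1]
  · simp [h2]

theorem smul_e1_injective {r s : ℝ} (h : r • e1 n = s • e1 n) : r = s := by
  simpa [dot_smul_left, dot_e1_e1] using congrArg (dot · (e1 n)) h

theorem e1_one : e1 1 = ![1, 0, 0] := by
  ext i
  fin_cases i <;> rfl

variable {W : Submodule ℝ (Fin (2*n+1) → ℝ)}

theorem vprod_mem (he : e1 n ∈ W) {x y : Fin (2*n+1) → ℝ} (hx : x ∈ W) (hy : y ∈ W) :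
    vprod n x y ∈ W :=
  W.add_mem (W.sub_mem (W.add_mem (W.smul_mem _ hy) (W.smul_mem _ hx)) (W.smul_mem _ he))
    (W.smul_mem _ he)

/-- A square root of `-e₁` that is not a multiple of `e₁` is a unit vector orthogonal to `e₁`. -/
theorem dot_eq_of_vprod_self_eq_neg_e1 {a : Fin (2*n+1) → ℝ} (h : vprod n a a = -e1 n)
    (ha : ∀ r : ℝ, a ≠ r • e1 n) : dot a (e1 n) = 0 ∧ dot a a = 1 := by
  rw [vprod_self] at h
  have h0 : dot a (e1 n) = 0 := by
    by_contra h0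
    refine ha ((2 * dot a (e1 n))⁻¹ * (dot a a - 1)) ?_
    have h' : (2 * dot a (e1 n)) • a = (dot a a - 1) • e1 n := by
      rw [sub_eq_iff_eq_add.mp h]
      module
    rw [mul_smul, ← h', inv_smul_smul₀ (mul_ne_zero two_ne_zero h0)]
  refine ⟨h0, smul_e1_injective (n := n) ?_⟩
  rw [h0, mul_zero, zero_smul, zero_sub, neg_inj] at h
  rw [h, one_smul]

theorem exists_orthonormal_of_iso (he : e1 n ∈ W) (φ : W →ₗ[ℝ] (Fin (2*1+1) → ℝ))
    (hφ : Function.Bijective φ)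
    (hmul : ∀ (x y : W) (h : vprod n x.1 y.1 ∈ W),
      φ ⟨vprod n x.1 y.1, h⟩ = vprod 1 (φ x) (φ y)) :
    ∃ u v : Fin (2*n+1) → ℝ, u ∈ W ∧ v ∈ W ∧ dot u (e1 n) = 0 ∧ dot v (e1 n) = 0 ∧
      dot u u = 1 ∧ dot v v = 1 ∧ dot u v = 0 ∧ omg n u v = 1 := by
  have hone : φ ⟨e1 n, he⟩ = e1 1 := by
    obtain ⟨w, hw⟩ := hφ.2 (e1 1)
    have h := hmul ⟨e1 n, he⟩ w (vprod_mem he he w.2)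
    simp only [vprod_e1_left, hw, vprod_e1_right] at h
    rw [← h, ← hw]
  have hlift : ∀ (x y : W) (r : ℝ), vprod 1 (φ x) (φ y) = r • e1 1 →
      vprod n x.1 y.1 = r • e1 n := by
    intro x y r h
    rw [← hmul x y (vprod_mem he x.2 y.2), ← hone, ← map_smul] at h
    exact congrArg Subtype.val (hφ.1 h)
  obtain ⟨u, hu⟩ := hφ.2 ![0, 1, 0]
  obtain ⟨v, hv⟩ := hφ.2 ![0, 0, 1]
  have huu : vprod n u.1 u.1 = -e1 n := by
    rw [hlift u u (-1) (by simp [hu, vprod_one, e1_one]), neg_one_smul]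
  have hvv : vprod n v.1 v.1 = -e1 n := by
    rw [hlift v v (-1) (by simp [hv, vprod_one, e1_one]), neg_one_smul]
  have huv : vprod n u.1 v.1 = (1 : ℝ) • e1 n :=
    hlift u v 1 (by simp [hu, hv, vprod_one, e1_one])
  have hvu : vprod n v.1 u.1 = (-1 : ℝ) • e1 n :=
    hlift v u (-1) (by simp [hu, hv, vprod_one, e1_one])
  have hne : ∀ (x : W) (r : ℝ), x.1 = r • e1 n → φ x = r • e1 1 := by
    intro x r h
    rw [← hone, ← map_smul]
    exact congrArg φ (Subtype.ext h)
  obtain ⟨hu0, hu1⟩ := dot_eq_of_vprod_self_eq_neg_e1 huu fun r h => by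
    simpa [hu, e1_one] using congrFun (hne u r h) 1
  obtain ⟨hv0, hv1⟩ := dot_eq_of_vprod_self_eq_neg_e1 hvv fun r h => by
    simpa [hv, e1_one] using congrFun (hne v r h) 2
  rw [vprod_of_dot_e1_eq_zero hu0 hv0] at huv
  rw [vprod_of_dot_e1_eq_zero hv0 hu0, omg_swap u.1, dot_comm v.1] at hvu
  have h1 := smul_e1_injective huv
  have h2 := smul_e1_injective hvu
  exact ⟨u, v, u.2, v.2, hu0, hv0, hu1, hv1, by linarith, by linarith⟩

/-- The coordinates of `x` along `e₁`, `u`, `v`. -/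
def coordMap (n : ℕ) (u v : Fin (2*n+1) → ℝ) : (Fin (2*n+1) → ℝ) →ₗ[ℝ] (Fin (2*1+1) → ℝ) where
  toFun x := ![dot x (e1 n), dot x u, dot x v]
  map_add' x y := by simp [dot_add_left]
  map_smul' r x := by simp [dot_smul_left]

theorem exists_iso_of_orthonormal (hW3 : Module.finrank ℝ W = 3) (he : e1 n ∈ W)
    {u v : Fin (2*n+1) → ℝ} (hu : u ∈ W) (hv : v ∈ W) (hu0 : dot u (e1 n) = 0)
    (hv0 : dot v (e1 n) = 0) (hu1 : dot u u = 1) (hv1 : dot v v = 1) (huv : dot u v = 0)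
    (homg : omg n u v = 1) :
    ∃ φ : W →ₗ[ℝ] (Fin (2*1+1) → ℝ), Function.Bijective φ ∧
      ∀ (x y : W) (h : vprod n x.1 y.1 ∈ W),
        φ ⟨vprod n x.1 y.1, h⟩ = vprod 1 (φ x) (φ y) := by
  have hu0' : dot (e1 n) u = 0 := by rw [dot_comm, hu0]
  have hv0' : dot (e1 n) v = 0 := by rw [dot_comm, hv0]
  have hvu : dot v u = 0 := by rw [dot_comm, huv]
  have hcoord : ∀ a b c : ℝ, coordMap n u v (a • e1 n + b • u + c • v) = ![a, b, c] := by
    intro a b c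
    simp [coordMap, dot_add_left, dot_smul_left, dot_e1_e1, *]
  have hmem : ∀ a b c : ℝ, a • e1 n + b • u + c • v ∈ W := fun a b c =>
    W.add_mem (W.add_mem (W.smul_mem a he) (W.smul_mem b hu)) (W.smul_mem c hv)
  let φ := (coordMap n u v).domRestrict W
  have hsurj : Function.Surjective φ := by
    intro y
    refine ⟨⟨_, hmem (y 0) (y 1) (y 2)⟩, (hcoord _ _ _).trans ?_⟩
    ext i
    fin_cases i <;> rfl
  have hinj : Function.Injective φ :=
    (LinearMap.injective_iff_surjective_of_finrank_eq_finrank (by simp [hW3])).mpr hsurj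
  have hexp : ∀ x : W, x.1 = dot x.1 (e1 n) • e1 n + dot x.1 u • u + dot x.1 v • v := by
    intro x
    have h : φ x = φ ⟨_, hmem (dot x.1 (e1 n)) (dot x.1 u) (dot x.1 v)⟩ := (hcoord _ _ _).symm
    exact congrArg Subtype.val (hinj h)
  refine ⟨φ, ⟨hinj, hsurj⟩, fun x y h => ?_⟩
  have hdot : dot x.1 y.1 =
      dot x.1 (e1 n) * dot y.1 (e1 n) + dot x.1 u * dot y.1 u + dot x.1 v * dot y.1 v := by
    conv_lhs => rw [hexp y]
    simp only [dot_add_right, dot_smul_right]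
    ring
  have homg' : omg n x.1 y.1 = dot x.1 u * dot y.1 v - dot x.1 v * dot y.1 u := by
    conv_lhs => rw [hexp x, hexp y]
    simp only [omg_add_left, omg_add_right, omg_smul_left, omg_smul_right, omg_e1_left,
      omg_e1_right, omg_self, omg_swap u v, homg]
    ring
  rw [vprod_one]
  change ![dot (vprod n x.1 y.1) (e1 n), dot (vprod n x.1 y.1) u, dot (vprod n x.1 y.1) v] =
    ![dot x.1 (e1 n) * dot y.1 (e1 n) - dot x.1 u * dot y.1 u - dot x.1 v * dot y.1 v +
        (dot x.1 u * dot y.1 v - dot x.1 v * dot y.1 u),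
      dot x.1 (e1 n) * dot y.1 u + dot y.1 (e1 n) * dot x.1 u,
      dot x.1 (e1 n) * dot y.1 v + dot y.1 (e1 n) * dot x.1 v]
  simp only [vprod, dot_add_left, dot_sub_left, dot_smul_left, dot_e1_e1, hu0', hv0', hdot, homg']
  congr 1
  · ring
  · congr 1
    · ring
    · congr 1
      ring

end Product

/-- A 3-dimensional subspace `W ∋ e₁` is closed under the Vidinli
multiplication, and `(W, ∗)` is isomorphic to the 3-dimensional Vidinli algebra
`V₃` iff `W ∩ V₀` contains orthonormal vectors `u, v` with `ω(u,v) = ±1`.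
In particular, orthonormal `u, v ∈ V₀` with `ω(u,v) = 1` reproduce the
multiplication table of `V₃`. -/
theorem vidinli_three_dim_subalgebras (n : ℕ) (hn : 1 ≤ n)
    (W : Submodule ℝ (Fin (2*n+1) → ℝ))
    (hW3 : Module.finrank ℝ ↥W = 3) (he : e1 n ∈ W) :
    (∀ x ∈ W, ∀ y ∈ W, vprod n x y ∈ W) ∧
    ((∃ φ : ↥W →ₗ[ℝ] (Fin (2*1+1) → ℝ), Function.Bijective φ ∧
        ∀ (x y : ↥W) (h : vprod n x.1 y.1 ∈ W),
          φ ⟨vprod n x.1 y.1, h⟩ = vprod 1 (φ x) (φ y)) ↔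
      (∃ u v : Fin (2*n+1) → ℝ, u ∈ W ∧ v ∈ W ∧
        dot u (e1 n) = 0 ∧ dot v (e1 n) = 0 ∧
        dot u u = 1 ∧ dot v v = 1 ∧ dot u v = 0 ∧
        (omg n u v = 1 ∨ omg n u v = -1))) ∧
    (∀ u v : Fin (2*n+1) → ℝ,
      dot u (e1 n) = 0 → dot v (e1 n) = 0 →
      dot u u = 1 → dot v v = 1 → dot u v = 0 → omg n u v = 1 →
      vprod n u v = e1 n ∧ vprod n v u = -(e1 n) ∧
      vprod n u u = -(e1 n) ∧ vprod n v v = -(e1 n)) := by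
  refine ⟨fun x hx y hy => vprod_mem he hx hy, ⟨?_, ?_⟩, ?_⟩
  · rintro ⟨φ, hφ, hmul⟩
    obtain ⟨u, v, hu, hv, hu0, hv0, hu1, hv1, huv, h⟩ := exists_orthonormal_of_iso he φ hφ hmul
    exact ⟨u, v, hu, hv, hu0, hv0, hu1, hv1, huv, Or.inl h⟩
  · rintro ⟨u, v, hu, hv, hu0, hv0, hu1, hv1, huv, h | h⟩
    · exact exists_iso_of_orthonormal hW3 he hu hv hu0 hv0 hu1 hv1 huv h
    · exact exists_iso_of_orthonormal hW3 he hv hu hv0 hu0 hv1 hu1 (by rw [dot_comm, huv])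
        (by rw [omg_swap u, h, neg_neg])
  · intro u v hu0 hv0 hu1 hv1 huv h
    refine ⟨?_, ?_, ?_, ?_⟩
    · simp [vprod_of_dot_e1_eq_zero hu0 hv0, huv, h]
    · simp [vprod_of_dot_e1_eq_zero hv0 hu0, dot_comm v u, omg_swap u v, huv, h]
    · simp [vprod_of_dot_e1_eq_zero hu0 hu0, omg_self, hu1]
    · simp [vprod_of_dot_e1_eq_zero hv0 hv0, omg_self, hv1]
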